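/- Let f be a real additive arithmetical function such that the series Σ_p min(1, f(p)²)/p and Σ_{p : |f(p)|≤1} f(p)/p converge, but Σ_{p : f(p)≠0} 1/p < ∞. Then, uniformly for x ≥ 2, sup_{y∈ℝ} |F_x(y) − F(y)| ≪ α_f(x^{1/log₂ x}) + β_f(√x)^{1/4} + 1/(log x)^{1/6}, where the implied constant may depend on f. -/

import Mathlib

open Filter Topology Finset MeasureTheory
open scoped Classical

noncomputable section

/-- A real additive arithmetic function. -/
def IsAdditive (f : ℕ → ℝ) : Prop :=
  ∀ m n : ℕ, 0 < m → 0 < n → Nat.Coprime m n → f (m * n) = f m + f n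

/-- A real strongly additive arithmetic function. -/
def IsStronglyAdditive (f : ℕ → ℝ) : Prop :=
  IsAdditive f ∧ ∀ p ν : ℕ, p.Prime → 1 ≤ ν → f (p ^ ν) = f p

/-- Convergence of the two Erdős–Wintner series. -/
def EWConv (f : ℕ → ℝ) : Prop :=
  Summable (fun p : Nat.Primes => min 1 (f p ^ 2) / (p : ℝ)) ∧
  ∃ ℓ : ℝ, Tendsto (fun N : ℕ =>
      ∑ p ∈ (Finset.range N).filter (fun p => Nat.Prime p ∧ |f p| ≤ 1), f p / (p : ℝ))
    atTop (𝓝 ℓ)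

/-- The series over primes with f(p) ≠ 0 of 1/p. -/
def DivergentCase (f : ℕ → ℝ) : Prop :=
  ¬ Summable (fun p : Nat.Primes => if f (p : ℕ) ≠ 0 then (1 : ℝ) / (p : ℕ) else 0)

def EtaBound (f : ℕ → ℝ) (η : ℝ → ℝ) : Prop :=
  Continuous η ∧ Antitone η ∧ Tendsto η atTop (𝓝 0) ∧
  (∀ y : ℝ, 1 ≤ y → ∃ ℓ : ℝ,
    Tendsto (fun N : ℕ =>
        ∑ p ∈ (Finset.range N).filter (fun p => Nat.Prime p ∧ y < (p : ℝ) ∧ |f p| ≤ 1),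
          f p / (p : ℝ)) atTop (𝓝 ℓ) ∧ |ℓ| ≤ η y) ∧
  (∀ y : ℝ, 1 ≤ y →
    (∑' n : ℕ, if IsPrimePow n ∧ y < (n : ℝ) then min 1 (f n ^ 2) / (n : ℝ) else 0) ≤ η y)

/-- The truncated additive function f_R. -/
def fR (f : ℕ → ℝ) (R : ℝ) (n : ℕ) : ℝ :=
  ∑ p ∈ n.primeFactors,
    (if ((p ^ (n.factorization p) : ℕ) : ℝ) ≤ R ∨ |f (p ^ (n.factorization p))| ≤ 1
      then f (p ^ (n.factorization p)) else 0)

/-- B_f(v) := sqrt(2 + Σ_{p^ν ≤ v} f(p^ν)²/p^ν). -/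
def Bf (f : ℕ → ℝ) (v : ℝ) : ℝ :=
  Real.sqrt (2 + ∑ n ∈ (Finset.Icc 2 ⌊v⌋₊).filter IsPrimePow, f n ^ 2 / (n : ℝ))

/-- π_k(x) = #{n ≤ x : ω(n) = k}. -/
def pik (x : ℝ) (k : ℕ) : ℕ :=
  ((Finset.Icc 1 ⌊x⌋₊).filter (fun n => n.primeFactors.card = k)).card

/-- The empirical distribution function. -/
def Fx (f : ℕ → ℝ) (x : ℝ) (y : ℝ) : ℝ :=
  (((Finset.Icc 1 ⌊x⌋₊).filter (fun n => f n ≤ y)).card : ℝ) / x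

def uf (f : ℕ → ℝ) (m : ℕ) : ℝ :=
  if ∀ p ∈ m.primeFactors, f (p ^ (m.factorization p)) ≠ 0 then 1 else 0

def vf (f : ℕ → ℝ) (d : ℕ) : ℝ :=
  if ∀ p ∈ d.primeFactors, f (p ^ (d.factorization p)) = 0 then 1 else 0

def wp (f : ℕ → ℝ) (p : ℕ) : ℝ :=
  (1 - 1 / (p : ℝ)) * ∑' ν : ℕ, uf f (p ^ (ν + 1)) / (p : ℝ) ^ (ν + 1)

def hf (f : ℕ → ℝ) (m : ℕ) : ℝ :=
  uf f m * ∏ p ∈ m.primeFactors, (1 - 1 / (p : ℝ)) / (1 - wp f p)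

def alphaf (f : ℕ → ℝ) (y : ℝ) : ℝ :=
  ∑' p : Nat.Primes, if y < ((p : ℕ) : ℝ) then uf f (p : ℕ) / ((p : ℕ) : ℝ) else 0

def betaf (f : ℕ → ℝ) (y : ℝ) : ℝ :=
  (1 / Real.log y) * ∫ t in (1:ℝ)..y, alphaf f t / t

def Flim (f : ℕ → ℝ) (y : ℝ) : ℝ :=
  (∏' p : Nat.Primes, (1 - wp f (p : ℕ))) *
    ∑' m : ℕ, if 1 ≤ m ∧ f m ≤ y then hf f m / m else 0

lemma euler_bound (a : ℕ → ℝ) (a0 : ∀ n, 0 ≤ a n) (h0 : a 0 = 0) (h1 : a 1 = 1)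
    (hmul : ∀ {m n : ℕ}, m.Coprime n → a (m * n) = a m * a n) (t : ℕ → ℝ)
    (hp : ∀ p : ℕ, p.Prime → Summable (fun ν => a (p ^ ν)) ∧ ∑' ν, a (p ^ (ν + 1)) ≤ t p)
    (T : ℝ) (hT : ∀ N : ℕ, ∑ p ∈ N.primesBelow, t p ≤ T) :
    Summable a ∧ ∑' n, a n ≤ Real.exp T := by
  have key : ∀ N : ℕ, ∑ n ∈ Finset.range N, a n ≤ Real.exp T := by
    intro N
    have hs := (EulerProduct.summable_and_hasSum_smoothNumbers_prod_primesBelow_tsum (f := a) h1 hmul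
      (fun {p} h => by simpa [Real.norm_eq_abs, abs_of_nonneg (a0 _)] using (hp p h).1) N).2
    have hs' : HasSum ((N.smoothNumbers).indicator a) (∏ p ∈ N.primesBelow, ∑' n : ℕ, a (p ^ n)) :=
      hasSum_subtype_iff_indicator.mp hs
    calc ∑ n ∈ Finset.range N, a n = ∑ n ∈ Finset.range N, (N.smoothNumbers).indicator a n := by
          refine Finset.sum_congr rfl fun n hn => ?_
          rcases Nat.eq_zero_or_pos n with rfl | hpos
          · rw [h0]; symm
            by_cases h : 0 ∈ N.smoothNumbers <;> simp [h, h0]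
          · rw [Set.indicator_of_mem]
            exact Nat.mem_smoothNumbers_of_lt hpos (Finset.mem_range.mp hn)
      _ ≤ ∏ p ∈ N.primesBelow, ∑' n : ℕ, a (p ^ n) :=
          sum_le_hasSum _ (fun i _ => Set.indicator_nonneg (fun n _ => a0 n) i) hs'
      _ ≤ ∏ p ∈ N.primesBelow, Real.exp (t p) := by
          refine Finset.prod_le_prod (fun p _ => tsum_nonneg fun _ => a0 _) fun p hpp => ?_
          have h := hp p (Nat.prime_of_mem_primesBelow hpp)
          rw [h.1.tsum_eq_zero_add, pow_zero, h1]
          have := Real.add_one_le_exp (t p)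
          linarith [h.2]
      _ = Real.exp (∑ p ∈ N.primesBelow, t p) := (Real.exp_sum _ _).symm
      _ ≤ _ := Real.exp_le_exp.mpr (hT N)
  exact ⟨summable_of_sum_range_le a0 key, Real.tsum_le_of_sum_range_le a0 key⟩

/-- weight: `2^ω(k)` if all primes exactly dividing `k` satisfy `P`. -/
def bP (P : ℕ → Prop) (k : ℕ) : ℝ :=
  if k ≠ 0 ∧ ∀ p : ℕ, p.Prime → p ∣ k → ¬ p ^ 2 ∣ k → P p then 2 ^ k.primeFactors.card else 0

lemma bP_nonneg (P : ℕ → Prop) (k : ℕ) : 0 ≤ bP P k := by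
  unfold bP; split_ifs <;> positivity

lemma bP_zero (P : ℕ → Prop) : bP P 0 = 0 := by simp [bP]

lemma bP_one (P : ℕ → Prop) : bP P 1 = 1 := by
  unfold bP
  rw [if_pos]
  · simp
  · exact ⟨one_ne_zero, fun p hp h => absurd (Nat.dvd_one.mp h) hp.ne_one⟩

lemma bP_mul (P : ℕ → Prop) {m n : ℕ} (h : m.Coprime n) : bP P (m * n) = bP P m * bP P n := by
  rcases Nat.eq_zero_or_pos m with rfl | hm
  · simp [bP_zero]
  rcases Nat.eq_zero_or_pos n with rfl | hn
  · simp [bP_zero]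
  have aux : ∀ {m n : ℕ}, m.Coprime n → 0 < m → 0 < n → ∀ p : ℕ, p.Prime → p ∣ m →
      (p ^ 2 ∣ m * n ↔ p ^ 2 ∣ m) := by
    intro m n h hm hn p hp hd
    constructor
    · intro h2
      have : Nat.Coprime (p ^ 2) n := Nat.Coprime.pow_left 2 (h.coprime_dvd_left hd)
      exact this.dvd_of_dvd_mul_right h2
    · intro h2; exact h2.mul_right n
  unfold bP
  have hiff : (m * n ≠ 0 ∧ ∀ p : ℕ, p.Prime → p ∣ m * n → ¬ p ^ 2 ∣ m * n → P p) ↔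
      (m ≠ 0 ∧ ∀ p : ℕ, p.Prime → p ∣ m → ¬ p ^ 2 ∣ m → P p) ∧
      (n ≠ 0 ∧ ∀ p : ℕ, p.Prime → p ∣ n → ¬ p ^ 2 ∣ n → P p) := by
    constructor
    · rintro ⟨_, H⟩
      refine ⟨⟨hm.ne', fun p hp hd h2 => H p hp (hd.mul_right n) ?_⟩,
        ⟨hn.ne', fun p hp hd h2 => H p hp (hd.mul_left m) ?_⟩⟩
      · rwa [aux h hm hn p hp hd]
      · rwa [mul_comm, aux h.symm hn hm p hp hd]
    · rintro ⟨⟨_, H1⟩, ⟨_, H2⟩⟩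
      refine ⟨by positivity, fun p hp hd h2 => ?_⟩
      rcases (Nat.Prime.dvd_mul hp).mp hd with hd | hd
      · exact H1 p hp hd (by rwa [aux h hm hn p hp hd] at h2)
      · exact H2 p hp hd (by rwa [mul_comm, aux h.symm hn hm p hp hd] at h2)
  rw [if_congr hiff rfl rfl, h.primeFactors_mul, Finset.card_union_of_disjoint h.disjoint_primeFactors]
  by_cases hA : (m ≠ 0 ∧ ∀ p : ℕ, p.Prime → p ∣ m → ¬ p ^ 2 ∣ m → P p)
  · by_cases hB : (n ≠ 0 ∧ ∀ p : ℕ, p.Prime → p ∣ n → ¬ p ^ 2 ∣ n → P p)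
    · rw [if_pos ⟨hA, hB⟩, if_pos hA, if_pos hB, pow_add]
    · rw [if_neg (fun h => hB h.2), if_neg hB, mul_zero]
  · rw [if_neg (fun h => hA h.1), if_neg hA, zero_mul]

lemma bP_prime (P : ℕ → Prop) {p : ℕ} (hp : p.Prime) : bP P p = if P p then 2 else 0 := by
  unfold bP
  refine Eq.trans (if_congr ?_ ?_ rfl) rfl
  · constructor
    · rintro ⟨_, H⟩
      refine H p hp dvd_rfl ?_
      intro h
      have := Nat.le_of_dvd hp.pos h
      nlinarith [hp.two_le]
    · intro h
      refine ⟨hp.ne_zero, fun q hq hd _ => ?_⟩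
      rwa [(Nat.prime_dvd_prime_iff_eq hq hp).mp hd]
  · simp [hp.primeFactors]

lemma bP_prime_pow_le (P : ℕ → Prop) {p : ℕ} (hp : p.Prime) (ν : ℕ) : bP P (p ^ (ν + 2)) ≤ 2 := by
  unfold bP
  split_ifs
  · rw [Nat.primeFactors_prime_pow (by omega) hp]; simp
  · norm_num

lemma rankin : ∃ K : ℝ, ∀ (Q : ℕ → Prop) (δ A : ℝ), 0 ≤ δ → δ ≤ 1 / 4 →
    (∀ N : ℕ, ∑ p ∈ N.primesBelow, (if Q p then (p : ℝ) ^ δ / p else 0) ≤ A) →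
    Summable (fun k : ℕ => bP Q k * ((k : ℝ) ^ δ / k)) ∧
    ∑' k : ℕ, bP Q k * ((k : ℝ) ^ δ / k) ≤ Real.exp (2 * A + K) := by
  have hz : Summable (fun n : ℕ => 5 * ((n : ℝ) ^ ((3 : ℝ) / 2))⁻¹) :=
    (Real.summable_nat_rpow_inv.mpr (by norm_num)).mul_left 5
  refine ⟨∑' n : ℕ, 5 * ((n : ℝ) ^ ((3 : ℝ) / 2))⁻¹, fun Q δ A hδ0 hδ hA => ?_⟩
  refine euler_bound (fun k : ℕ => bP Q k * ((k : ℝ) ^ δ / k)) ?_ ?_ ?_ ?_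
    (fun p => 2 * (if Q p then (p : ℝ) ^ δ / p else 0) + 5 * ((p : ℝ) ^ ((3 : ℝ) / 2))⁻¹) ?_ _ ?_
  · intro n; exact mul_nonneg (bP_nonneg _ _) (by positivity)
  · simp [bP_zero]
  · simp [bP_one]
  · intro m n h
    simp only [bP_mul Q h, Nat.cast_mul]
    rw [Real.mul_rpow (by positivity) (by positivity)]
    by_cases hm : (m : ℝ) = 0
    · simp [hm]
    by_cases hn : (n : ℝ) = 0
    · simp [hn]
    field_simp
  · intro p hp
    have hp0 : (0 : ℝ) < p := by exact_mod_cast hp.pos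
    have hp2 : (2 : ℝ) ≤ p := by exact_mod_cast hp.two_le
    set r : ℝ := (p : ℝ) ^ δ / p with hr
    have hr0 : 0 ≤ r := by positivity
    have hr' : r = (p : ℝ) ^ (δ - 1) := by rw [hr, Real.rpow_sub_one hp0.ne']
    have hr34 : r ≤ (p : ℝ) ^ (-(3 : ℝ) / 4) := by
      rw [hr']; exact Real.rpow_le_rpow_of_exponent_le (by linarith) (by linarith)
    have hr6 : r ≤ 3 / 5 := by
      refine hr34.trans ?_
      have h1 : (p : ℝ) ^ (-(3 : ℝ) / 4) ≤ 2 ^ (-(3 : ℝ) / 4) :=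
        Real.rpow_le_rpow_of_nonpos (by norm_num) hp2 (by norm_num)
      refine h1.trans ?_
      have h2 : ((2 : ℝ) ^ (-(3 : ℝ) / 4)) ^ (4 : ℕ) = 1 / 8 := by
        rw [← Real.rpow_natCast, ← Real.rpow_mul (by norm_num)]; norm_num [Real.rpow_neg]
      by_contra hcon
      push Not at hcon
      have := pow_lt_pow_left₀ hcon (by norm_num) (n := 4) (by norm_num)
      rw [h2] at this
      norm_num at this
    have hrsq : r ^ 2 ≤ ((p : ℝ) ^ ((3 : ℝ) / 2))⁻¹ := by
      rw [← Real.rpow_neg hp0.le]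
      calc r ^ 2 ≤ ((p : ℝ) ^ (-(3 : ℝ) / 4)) ^ 2 := by gcongr
        _ = _ := by
          rw [← Real.rpow_natCast, ← Real.rpow_mul hp0.le]; norm_num
    have hpow : ∀ ν : ℕ, (((p ^ ν : ℕ) : ℝ) ^ δ / ((p ^ ν : ℕ) : ℝ)) = r ^ ν := by
      intro ν
      push_cast
      rw [hr, div_pow, ← Real.rpow_natCast, ← Real.rpow_natCast, ← Real.rpow_mul hp0.le,
        ← Real.rpow_mul hp0.le, mul_comm]
    simp only [hpow]
    have hgeo : Summable (fun ν : ℕ => 2 * r ^ 2 * r ^ ν) :=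
      (summable_geometric_of_lt_one hr0 (by linarith)).mul_left _
    have hle : ∀ ν : ℕ, bP Q (p ^ (ν + 2)) * r ^ (ν + 2) ≤ 2 * r ^ 2 * r ^ ν := by
      intro ν
      have := bP_prime_pow_le Q hp ν
      calc bP Q (p ^ (ν + 2)) * r ^ (ν + 2) ≤ 2 * r ^ (ν + 2) := by gcongr
        _ = _ := by ring
    have hs2 : Summable (fun ν : ℕ => bP Q (p ^ (ν + 2)) * r ^ (ν + 2)) :=
      Summable.of_nonneg_of_le (fun ν => mul_nonneg (bP_nonneg _ _) (by positivity)) hle hgeo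
    have hs0 : Summable (fun ν : ℕ => bP Q (p ^ ν) * r ^ ν) :=
      (summable_nat_add_iff (f := fun ν : ℕ => bP Q (p ^ ν) * r ^ ν) 2).mp hs2
    have hs1 : Summable (fun ν : ℕ => bP Q (p ^ (ν + 1)) * r ^ (ν + 1)) :=
      (summable_nat_add_iff (f := fun ν : ℕ => bP Q (p ^ ν) * r ^ ν) 1).mpr hs0
    refine ⟨hs0, ?_⟩
    rw [hs1.tsum_eq_zero_add]
    have h3 : ∑' ν : ℕ, bP Q (p ^ (ν + 1 + 1)) * r ^ (ν + 1 + 1) ≤ 5 * r ^ 2 := by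
      calc _ ≤ ∑' ν : ℕ, 2 * r ^ 2 * r ^ ν := hs2.tsum_le_tsum hle hgeo
        _ = 2 * r ^ 2 * (1 - r)⁻¹ := by
          rw [tsum_mul_left, tsum_geometric_of_lt_one hr0 (by linarith)]
        _ ≤ 2 * r ^ 2 * (5 / 2) := by
          gcongr
          rw [inv_le_comm₀ (by linarith) (by norm_num)]
          linarith
        _ = _ := by ring
    have h4 : bP Q (p ^ (0 + 1)) * r ^ (0 + 1) = 2 * (if Q p then r else 0) := by
      simp only [zero_add, pow_one, bP_prime Q hp]
      split_ifs <;> simp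
    rw [h4]
    linarith
  · intro N
    rw [Finset.sum_add_distrib, ← Finset.mul_sum]
    have := hz.sum_le_tsum N.primesBelow (fun i _ => by positivity)
    linarith [hA N]

/-- `k` has an exact prime divisor above `z` in `P`. -/
def badk (P : ℕ → Prop) (z : ℝ) (k : ℕ) : Prop :=
  ∃ p : ℕ, p.Prime ∧ p ∣ k ∧ ¬ p ^ 2 ∣ k ∧ z < p ∧ P p

lemma bad_sum (P : ℕ → Prop) (hs : Summable (fun k : ℕ => bP P k / k))
    (hP : Summable (fun p : Nat.Primes => if P p then (1 : ℝ) / ((p : ℕ) : ℝ) else 0)) (z : ℝ) :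
    ∑' k : ℕ, (if badk P z k then bP P k / k else 0) ≤
      2 * (∑' p : Nat.Primes, if z < ((p : ℕ) : ℝ) then (if P p then (1 : ℝ) / ((p : ℕ) : ℝ) else 0) else 0)
        * ∑' k : ℕ, bP P k / k := by
  set c : Nat.Primes → ℝ := fun p =>
    if z < ((p : ℕ) : ℝ) then (if P p then (1 : ℝ) / ((p : ℕ) : ℝ) else 0) else 0 with hc
  have hc0 : ∀ p, 0 ≤ c p := by
    intro p; simp only [hc]; split_ifs <;> positivity
  have hb0 : ∀ k : ℕ, 0 ≤ bP P k / k := fun k => div_nonneg (bP_nonneg _ _) (by positivity)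
  have hcs : Summable c := by
    refine Summable.of_nonneg_of_le hc0 (fun p => ?_) hP
    simp only [hc]; split_ifs <;> first | exact le_rfl | positivity
  have hc2 : Summable (fun p => 2 * c p) := hcs.mul_left 2
  have hprod : Summable (fun x : Nat.Primes × ℕ => (2 * c x.1) * (bP P x.2 / x.2)) :=
    hc2.mul_of_nonneg hs (fun p => by have := hc0 p; positivity) hb0
  let S : Set ℕ := {k | badk P z k}
  have hS : ∀ k : S, ∃ p : ℕ, p.Prime ∧ p ∣ (k : ℕ) ∧ ¬ p ^ 2 ∣ (k : ℕ) ∧ z < p ∧ P p := fun k => k.2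
  choose q hq1 hq2 hq3 hq4 hq5 using hS
  have h1 : ∑' k : ℕ, (if badk P z k then bP P k / k else 0) = ∑' k : S, bP P (k : ℕ) / ((k : ℕ) : ℝ) := by
    rw [tsum_subtype S (fun k : ℕ => bP P k / (k : ℝ))]
    refine tsum_congr fun k => ?_
    by_cases h : badk P z k
    · rw [if_pos h, Set.indicator_of_mem (show k ∈ S from h)]
    · rw [if_neg h, Set.indicator_of_notMem (show k ∉ S from h)]
  rw [h1]
  calc ∑' k : S, bP P (k : ℕ) / ((k : ℕ) : ℝ)
      ≤ ∑' x : Nat.Primes × ℕ, (2 * c x.1) * (bP P x.2 / x.2) := by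
        refine Summable.tsum_le_tsum_of_inj
          (fun k : S => ((⟨q k, hq1 k⟩, (k : ℕ) / q k) : Nat.Primes × ℕ)) ?_ ?_ ?_ ?_ hprod
        · intro k l hkl
          have e1 : q k = q l := congrArg (fun x : Nat.Primes × ℕ => (x.1 : ℕ)) hkl
          have e2 : (k : ℕ) / q k = (l : ℕ) / q l := congrArg (fun x : Nat.Primes × ℕ => x.2) hkl
          apply Subtype.ext
          rw [← Nat.mul_div_cancel' (hq2 k), ← Nat.mul_div_cancel' (hq2 l), e2, e1]
        · intro x _
          exact mul_nonneg (by have := hc0 x.1; positivity) (hb0 _)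
        · intro k
          obtain ⟨j, hj⟩ := hq2 k
          have hpos := (hq1 k).pos
          have hjd : (k : ℕ) / q k = j := by rw [hj]; exact Nat.mul_div_cancel_left _ hpos
          have hcop : Nat.Coprime (q k) j := by
            rw [(hq1 k).coprime_iff_not_dvd]
            intro hd
            apply hq3 k
            rw [hj, pow_two]
            exact Nat.mul_dvd_mul_left _ hd
          simp only [hjd]
          have hcv : c ⟨q k, hq1 k⟩ = 1 / (q k : ℝ) := by
            simp only [hc]
            rw [if_pos (hq4 k), if_pos (hq5 k)]
          rw [hcv, hj, bP_mul P hcop, bP_prime P (hq1 k), if_pos (hq5 k)]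
          push_cast
          apply le_of_eq
          rw [mul_div_mul_comm]; ring
        · exact hs.subtype S
    _ = (∑' p, 2 * c p) * ∑' k : ℕ, bP P k / k := by
        rw [Summable.tsum_mul_tsum hc2 hs hprod]
    _ = _ := by rw [tsum_mul_left]

lemma bP_le_split (P : ℕ → Prop) (z : ℝ) (k : ℕ) :
    bP P k ≤ (if badk P z k then bP P k else 0) + bP (fun p => P p ∧ (p : ℝ) ≤ z) k := by
  by_cases h : badk P z k
  · rw [if_pos h]; have := bP_nonneg (fun p => P p ∧ (p : ℝ) ≤ z) k; linarith
  · rw [if_neg h, zero_add]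
    unfold bP
    split_ifs with h1 h2
    · exact le_rfl
    · exfalso
      apply h2
      refine ⟨h1.1, fun p hp hd h2 => ⟨h1.2 p hp hd h2, ?_⟩⟩
      by_contra hlt
      exact h ⟨p, hp, hd, h2, not_le.mp hlt, h1.2 p hp hd h2⟩
    · positivity
    · exact le_rfl

lemma bP_mono {P Q : ℕ → Prop} (h : ∀ p, P p → Q p) (k : ℕ) : bP P k ≤ bP Q k := by
  unfold bP
  split_ifs with h1 h2
  · exact le_rfl
  · exact absurd ⟨h1.1, fun p hp hd h2 => h _ (h1.2 p hp hd h2)⟩ h2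
  · positivity
  · exact le_rfl

lemma primesBelow_sum_le (g : ℕ → ℝ) (hg : ∀ n, 0 ≤ g n)
    (hs : Summable (fun p : Nat.Primes => g p)) (N : ℕ) :
    ∑ p ∈ N.primesBelow, g p ≤ ∑' p : Nat.Primes, g p := by
  have h1 : ∑ p ∈ N.primesBelow, g p = ∑ p ∈ N.primesBelow.subtype Nat.Prime, g (p : ℕ) := by
    rw [Finset.sum_subtype_of_mem (f := g)]
    intro p hp; exact Nat.prime_of_mem_primesBelow hp
  rw [h1]
  have h2 : ∑ p ∈ (N.primesBelow.subtype Nat.Prime : Finset Nat.Primes), g (p : ℕ) ≤ ∑' p : Nat.Primes, g p :=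
    Summable.sum_le_tsum (ι := Nat.Primes) _ (fun i _ => hg _) hs
  exact h2

/-- Summability of the majorant and the tail estimate. -/
lemma tail_bound (P : ℕ → Prop)
    (hP : Summable (fun p : Nat.Primes => if P p then (1 : ℝ) / ((p : ℕ) : ℝ) else 0)) :
    Summable (fun k : ℕ => bP P k / k) ∧ ∃ C : ℝ, 0 ≤ C ∧ ∀ (z δ Y : ℝ), 1 ≤ z → 0 ≤ δ → δ ≤ 1 / 4 →
      z ^ δ ≤ Real.exp 1 → 0 < Y →
      ∑' k : ℕ, (if Y < k then bP P k / k else 0) ≤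
        C * ((∑' p : Nat.Primes, if z < ((p : ℕ) : ℝ) then (if P p then (1 : ℝ) / ((p : ℕ) : ℝ) else 0) else 0)
          + 1 / Y ^ δ) := by
  obtain ⟨K, hK⟩ := rankin
  set S := ∑' p : Nat.Primes, (if P p then (1 : ℝ) / ((p : ℕ) : ℝ) else 0) with hS
  have hpb := primesBelow_sum_le (fun p : ℕ => if P p then (1 : ℝ) / (p : ℝ) else 0)
    (fun n => by split_ifs <;> positivity) hP
  have hb0 : ∀ k : ℕ, 0 ≤ bP P k / k := fun k => div_nonneg (bP_nonneg _ _) (by positivity)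
  have hsum : Summable (fun k : ℕ => bP P k / k) := by
    have := (hK P 0 S le_rfl (by norm_num) (fun N => by simpa [hS] using hpb N)).1
    simpa [div_eq_mul_inv] using this
  refine ⟨hsum, ?_⟩
  set B := ∑' k : ℕ, bP P k / k with hB
  have hB0 : 0 ≤ B := tsum_nonneg hb0
  set E := Real.exp (2 * (Real.exp 1 * S) + K) with hE
  refine ⟨2 * B + E, by positivity, fun z δ Y hz hδ0 hδ hzδ hY => ?_⟩
  set A := ∑' p : Nat.Primes, (if z < ((p : ℕ) : ℝ) then (if P p then (1 : ℝ) / ((p : ℕ) : ℝ) else 0) else 0) with hA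
  have hA0 : 0 ≤ A := tsum_nonneg fun p => by split_ifs <;> positivity
  set Q : ℕ → Prop := fun p => P p ∧ (p : ℝ) ≤ z with hQ
  have hbad := bad_sum P hsum hP z
  obtain ⟨hR1, hR2⟩ := hK Q δ (Real.exp 1 * S) hδ0 hδ (fun N => by
    refine le_trans ?_ (mul_le_mul_of_nonneg_left (hpb N) (Real.exp_pos 1).le)
    rw [Finset.mul_sum]
    refine Finset.sum_le_sum fun p _ => ?_
    by_cases h : Q p
    · rw [if_pos h, if_pos h.1, div_eq_mul_one_div]
      gcongr
      exact (Real.rpow_le_rpow (by positivity) h.2 hδ0).trans hzδ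
    · rw [if_neg h]; split_ifs <;> positivity)
  have hbs : Summable (fun k : ℕ => if badk P z k then bP P k / k else 0) := by
    refine Summable.of_nonneg_of_le (fun k => ?_) (fun k => ?_) hsum
    · split_ifs; exact hb0 k; exact le_rfl
    · split_ifs; exact le_rfl; exact hb0 k
  have hYδ : 0 < Y ^ δ := Real.rpow_pos_of_pos hY δ
  have hpt : ∀ k : ℕ, (if Y < k then bP P k / k else 0) ≤
      (if badk P z k then bP P k / k else 0) + (1 / Y ^ δ) * (bP Q k * ((k : ℝ) ^ δ / k)) := by
    intro k
    have hn : 0 ≤ (if badk P z k then bP P k / (k : ℝ) else 0) := by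
      split_ifs; exact hb0 k; exact le_rfl
    have hn2 : 0 ≤ bP Q k := bP_nonneg _ _
    by_cases h : Y < k
    · rw [if_pos h]
      have hsp := bP_le_split P z k
      have hk0 : (0 : ℝ) < k := hY.trans h
      have h1 : bP P k / k ≤ (if badk P z k then bP P k / (k : ℝ) else 0) + bP Q k / k := by
        have := div_le_div_of_nonneg_right hsp hk0.le
        rw [add_div] at this
        refine this.trans (le_of_eq ?_)
        congr 1
        split_ifs <;> simp
      refine h1.trans ?_
      gcongr
      have h2 : Y ^ δ ≤ (k : ℝ) ^ δ := Real.rpow_le_rpow hY.le h.le hδ0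
      have h3 : 1 ≤ (1 / Y ^ δ) * (k : ℝ) ^ δ := by
        rw [one_div, inv_mul_eq_div, le_div_iff₀ hYδ]; linarith
      calc bP Q k / k = 1 * (bP Q k / k) := by ring
        _ ≤ ((1 / Y ^ δ) * (k : ℝ) ^ δ) * (bP Q k / k) := by gcongr
        _ = _ := by ring
    · rw [if_neg h]; positivity
  have hRs := hR1.mul_left (1 / Y ^ δ)
  calc ∑' k : ℕ, (if Y < k then bP P k / k else 0)
      ≤ ∑' k : ℕ, ((if badk P z k then bP P k / k else 0) + (1 / Y ^ δ) * (bP Q k * ((k : ℝ) ^ δ / k))) := by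
        refine Summable.tsum_le_tsum hpt ?_ (hbs.add hRs)
        refine Summable.of_nonneg_of_le (fun k => ?_) hpt (hbs.add hRs)
        split_ifs; exact hb0 k; exact le_rfl
    _ = ∑' k : ℕ, (if badk P z k then bP P k / k else 0) + (1 / Y ^ δ) * ∑' k : ℕ, (bP Q k * ((k : ℝ) ^ δ / k)) := by
        rw [hbs.tsum_add hRs, tsum_mul_left]
    _ ≤ 2 * A * B + (1 / Y ^ δ) * E := by gcongr
    _ ≤ _ := by
        have h1 : 0 ≤ 1 / Y ^ δ := by positivity
        have h2 : 0 ≤ E := (Real.exp_pos _).le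
        nlinarith [mul_nonneg hA0 h2, mul_nonneg hB0 h1]

def toAF (G : ℕ → ℝ) : ArithmeticFunction ℝ := ⟨fun n => if n = 0 then 0 else G n, by simp⟩

lemma toAF_apply (G : ℕ → ℝ) {n : ℕ} (hn : n ≠ 0) : toAF G n = G n := by
  change (if n = 0 then 0 else G n) = G n
  rw [if_neg hn]

/-- Möbius transform. -/
def lam (G : ℕ → ℝ) : ArithmeticFunction ℝ := (ArithmeticFunction.moebius : ArithmeticFunction ℝ) * toAF G

lemma lam_mul_zeta (G : ℕ → ℝ) :
    lam G * ((ArithmeticFunction.zeta : ArithmeticFunction ℕ) : ArithmeticFunction ℝ) = toAF G := by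
  unfold lam
  rw [mul_comm, ← mul_assoc, ArithmeticFunction.coe_zeta_mul_coe_moebius, one_mul]

lemma sum_divisors_lam (G : ℕ → ℝ) {n : ℕ} (hn : n ≠ 0) : ∑ k ∈ n.divisors, lam G k = G n := by
  rw [← ArithmeticFunction.coe_mul_zeta_apply, lam_mul_zeta, toAF_apply G hn]

lemma sum_Ioc_lam (G : ℕ → ℝ) (N : ℕ) :
    ∑ n ∈ Finset.Ioc 0 N, G n = ∑ k ∈ Finset.Ioc 0 N, lam G k * ((N / k : ℕ) : ℝ) := by
  rw [← ArithmeticFunction.sum_Ioc_mul_zeta_eq_sum, lam_mul_zeta]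
  refine Finset.sum_congr rfl fun n hn => ?_
  rw [toAF_apply]
  have := (Finset.mem_Ioc.mp hn).1
  omega

lemma lam_eq (G : ℕ → ℝ) (k : ℕ) :
    lam G k = ∑ x ∈ k.divisorsAntidiagonal, (ArithmeticFunction.moebius x.1 : ℝ) * G x.2 := by
  unfold lam
  rw [ArithmeticFunction.mul_apply]
  refine Finset.sum_congr rfl fun x hx => ?_
  rw [toAF_apply, ArithmeticFunction.intCoe_apply]
  have := Nat.mem_divisorsAntidiagonal.mp hx
  rintro h
  rw [h, mul_zero] at this
  exact this.2 this.1.symm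

lemma sum_abs_moebius_le (k : ℕ) :
    ∑ x ∈ k.divisorsAntidiagonal, |(ArithmeticFunction.moebius x.1 : ℝ)| ≤ 2 ^ k.primeFactors.card := by
  rw [Nat.sum_divisorsAntidiagonal (fun a _ => |(ArithmeticFunction.moebius a : ℝ)|)]
  have h1 : ∀ d : ℕ, |(ArithmeticFunction.moebius d : ℝ)| = if Squarefree d then 1 else 0 := by
    intro d
    have := ArithmeticFunction.abs_moebius (n := d)
    rw [← Int.cast_abs, this]
    split_ifs <;> simp
  simp only [h1]
  rw [Finset.sum_boole]
  have h2 : ((k.divisors.filter Squarefree).card) ≤ k.primeFactors.powerset.card := by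
    refine Finset.card_le_card_of_injOn (fun d => d.primeFactors) ?_ ?_
    · intro d hd
      have hd := Finset.mem_filter.mp (Finset.mem_coe.mp hd)
      have h := Nat.mem_divisors.mp hd.1
      exact Finset.mem_coe.mpr (Finset.mem_powerset.mpr (Nat.primeFactors_mono h.1 h.2))
    · intro a ha b hb hab
      have ha := (Finset.mem_filter.mp (Finset.mem_coe.mp ha)).2
      have hb := (Finset.mem_filter.mp (Finset.mem_coe.mp hb)).2
      rw [← Nat.prod_primeFactors_of_squarefree ha, ← Nat.prod_primeFactors_of_squarefree hb]
      simp only at hab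
      rw [hab]
  rw [Finset.card_powerset] at h2
  exact_mod_cast h2

lemma lam_vanish (G : ℕ → ℝ) {p k' : ℕ} (hp : p.Prime) (hk : ¬ p ∣ k') (hk0 : k' ≠ 0)
    (hG : ∀ d, d ≠ 0 → ¬ p ∣ d → G (p * d) = G d) : lam G (p * k') = 0 := by
  have hcop : Nat.Coprime p k' := (Nat.Prime.coprime_iff_not_dvd hp).mpr hk
  rw [lam_eq, Nat.sum_divisorsAntidiagonal (fun a b => (ArithmeticFunction.moebius a : ℝ) * G b)]
  have himg : (p * k').divisors = (p.divisors ×ˢ k'.divisors).image (fun x : ℕ × ℕ => x.1 * x.2) := by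
    ext d
    rw [Nat.divisors_mul, Finset.mem_mul, Finset.mem_image]
    constructor
    · rintro ⟨a, ha, b, hb, rfl⟩
      exact ⟨(a, b), Finset.mem_product.mpr ⟨ha, hb⟩, rfl⟩
    · rintro ⟨x, hx, rfl⟩
      exact ⟨x.1, (Finset.mem_product.mp hx).1, x.2, (Finset.mem_product.mp hx).2, rfl⟩
  rw [himg, Finset.sum_image hcop.mul_injOn_divisors]
  rw [Finset.sum_product, hp.divisors, Finset.sum_pair hp.one_lt.ne, ← Finset.sum_add_distrib]
  refine Finset.sum_eq_zero fun d hd => ?_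
  have hdk := (Nat.mem_divisors.mp hd).1
  have hpd : Nat.Coprime p d := hcop.coprime_dvd_right hdk
  rw [ArithmeticFunction.isMultiplicative_moebius.map_mul_of_coprime hpd,
    ArithmeticFunction.moebius_apply_prime hp, one_mul, Nat.mul_div_mul_left _ _ hp.pos,
    Nat.mul_div_assoc _ hdk, hG]
  · push_cast; ring
  · have := Nat.div_pos (Nat.le_of_dvd (Nat.pos_of_ne_zero hk0) hdk) (Nat.pos_of_dvd_of_pos hdk (Nat.pos_of_ne_zero hk0))
    omega
  · intro h
    exact hk (h.trans (Nat.div_dvd_of_dvd hdk))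

lemma not_good_cases (P : ℕ → Prop) (k : ℕ) :
    k = 0 ∨ bP P k = 2 ^ k.primeFactors.card ∨
      ∃ p k' : ℕ, p.Prime ∧ ¬ p ∣ k' ∧ k' ≠ 0 ∧ ¬ P p ∧ k = p * k' := by
  by_cases hk : k = 0
  · exact Or.inl hk
  right
  by_cases h : (k ≠ 0 ∧ ∀ p : ℕ, p.Prime → p ∣ k → ¬ p ^ 2 ∣ k → P p)
  · left; unfold bP; rw [if_pos h]
  · right
    push Not at h
    obtain ⟨p, hp, hd, h2, hP⟩ := h hk
    obtain ⟨k', rfl⟩ := hd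
    refine ⟨p, k', hp, ?_, ?_, hP, rfl⟩
    · intro hd; apply h2; rw [pow_two]; exact Nat.mul_dvd_mul_left _ hd
    · rintro rfl; simp at hk

lemma lam_bound (P : ℕ → Prop) (G : ℕ → ℝ) (hG1 : ∀ d, |G d| ≤ 1)
    (hG : ∀ p, p.Prime → ¬ P p → ∀ d, d ≠ 0 → ¬ p ∣ d → G (p * d) = G d) (k : ℕ) :
    |lam G k| ≤ bP P k := by
  rcases not_good_cases P k with rfl | h | ⟨p, k', hp, hpk, hk, hPp, rfl⟩
  · simp [bP_zero]
  · rw [h, lam_eq]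
    refine (Finset.abs_sum_le_sum_abs _ _).trans (le_trans ?_ (sum_abs_moebius_le k))
    refine Finset.sum_le_sum fun x _ => ?_
    rw [abs_mul]
    exact mul_le_of_le_one_right (abs_nonneg _) (hG1 _)
  · rw [lam_vanish G hp hpk hk (hG p hp hPp), abs_zero]
    exact bP_nonneg _ _

/-! ### The decomposition `n = m d` -/

def UP (f : ℕ → ℝ) (m : ℕ) : Prop := ∀ p ∈ m.primeFactors, f (p ^ (m.factorization p)) ≠ 0
def VP (f : ℕ → ℝ) (m : ℕ) : Prop := ∀ p ∈ m.primeFactors, f (p ^ (m.factorization p)) = 0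

def fpart (s : ℕ → Prop) (n : ℕ) : ℕ := (n.factorization.filter s).prod (fun p k => p ^ k)

def mpart (f : ℕ → ℝ) (n : ℕ) : ℕ := fpart (fun p => f (p ^ (n.factorization p)) ≠ 0) n
def dpart (f : ℕ → ℝ) (n : ℕ) : ℕ := fpart (fun p => f (p ^ (n.factorization p)) = 0) n

lemma fpart_ne_zero (s : ℕ → Prop) (n : ℕ) : fpart s n ≠ 0 := by
  rw [fpart, Finsupp.prod, Finset.prod_ne_zero_iff]
  intro p hp
  rw [Finsupp.support_filter, Finset.mem_filter] at hp
  exact pow_ne_zero _ (Nat.prime_of_mem_primeFactors hp.1).ne_zero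

lemma fpart_fact (s : ℕ → Prop) (n p : ℕ) :
    (fpart s n).factorization p = if s p then n.factorization p else 0 := by
  have : (fpart s n).factorization = n.factorization.filter s := by
    unfold fpart
    refine Nat.prod_pow_factorization_eq_self ?_
    intro p hp
    rw [Finsupp.support_filter, Finset.mem_filter] at hp
    exact Nat.prime_of_mem_primeFactors hp.1
  rw [this, Finsupp.filter_apply]

lemma mpart_ne_zero (f : ℕ → ℝ) (n : ℕ) : mpart f n ≠ 0 := fpart_ne_zero _ _
lemma dpart_ne_zero (f : ℕ → ℝ) (n : ℕ) : dpart f n ≠ 0 := fpart_ne_zero _ _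

lemma mpart_fact_of_ne (f : ℕ → ℝ) (n p : ℕ) (h : f (p ^ (n.factorization p)) ≠ 0) :
    (mpart f n).factorization p = n.factorization p := by
  rw [mpart, fpart_fact, if_pos h]
lemma mpart_fact_of_eq (f : ℕ → ℝ) (n p : ℕ) (h : f (p ^ (n.factorization p)) = 0) :
    (mpart f n).factorization p = 0 := by
  rw [mpart, fpart_fact, if_neg (not_not.mpr h)]
lemma dpart_fact_of_ne (f : ℕ → ℝ) (n p : ℕ) (h : f (p ^ (n.factorization p)) ≠ 0) :
    (dpart f n).factorization p = 0 := by
  rw [dpart, fpart_fact, if_neg h]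
lemma dpart_fact_of_eq (f : ℕ → ℝ) (n p : ℕ) (h : f (p ^ (n.factorization p)) = 0) :
    (dpart f n).factorization p = n.factorization p := by
  rw [dpart, fpart_fact, if_pos h]

lemma mpart_mul_dpart (f : ℕ → ℝ) {n : ℕ} (hn : n ≠ 0) : mpart f n * dpart f n = n := by
  refine Nat.eq_of_factorization_eq (mul_ne_zero (mpart_ne_zero f n) (dpart_ne_zero f n)) hn fun p => ?_
  rw [Nat.factorization_mul (mpart_ne_zero f n) (dpart_ne_zero f n), Finsupp.add_apply]
  by_cases h : f (p ^ (n.factorization p)) = 0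
  · rw [mpart_fact_of_eq f n p h, dpart_fact_of_eq f n p h, zero_add]
  · rw [mpart_fact_of_ne f n p h, dpart_fact_of_ne f n p h, add_zero]

lemma fact_ne_zero {n p : ℕ} (h : p ∈ n.primeFactors) : n.factorization p ≠ 0 := by
  rwa [← Nat.support_factorization, Finsupp.mem_support_iff] at h

lemma mem_mpart (f : ℕ → ℝ) (n p : ℕ) (h : p ∈ (mpart f n).primeFactors) :
    f (p ^ (n.factorization p)) ≠ 0 ∧ (mpart f n).factorization p = n.factorization p := by
  have h0 : f (p ^ (n.factorization p)) ≠ 0 := fun h1 => fact_ne_zero h (mpart_fact_of_eq f n p h1)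
  exact ⟨h0, mpart_fact_of_ne f n p h0⟩

lemma mem_dpart (f : ℕ → ℝ) (n p : ℕ) (h : p ∈ (dpart f n).primeFactors) :
    f (p ^ (n.factorization p)) = 0 ∧ (dpart f n).factorization p = n.factorization p := by
  have h0 : f (p ^ (n.factorization p)) = 0 := by
    by_contra h1
    exact fact_ne_zero h (dpart_fact_of_ne f n p h1)
  exact ⟨h0, dpart_fact_of_eq f n p h0⟩

lemma UP_mpart (f : ℕ → ℝ) (n : ℕ) : UP f (mpart f n) := by
  intro p hp
  obtain ⟨h1, h2⟩ := mem_mpart f n p hp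
  rwa [h2]

lemma VP_dpart (f : ℕ → ℝ) (n : ℕ) : VP f (dpart f n) := by
  intro p hp
  obtain ⟨h1, h2⟩ := mem_dpart f n p hp
  rwa [h2]

lemma coprime_parts (f : ℕ → ℝ) (n : ℕ) : Nat.Coprime (mpart f n) (dpart f n) := by
  rw [← Nat.disjoint_primeFactors (mpart_ne_zero f n) (dpart_ne_zero f n), Finset.disjoint_left]
  intro p h1 h2
  exact (mem_mpart f n p h1).1 (mem_dpart f n p h2).1

lemma mpart_unique (f : ℕ → ℝ) {m e : ℕ} (hm : m ≠ 0) (he : e ≠ 0) (hc : Nat.Coprime m e)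
    (hU : UP f m) (hV : VP f e) : mpart f (m * e) = m := by
  refine Nat.eq_of_factorization_eq (mpart_ne_zero f _) hm fun p => ?_
  have hadd : (m * e).factorization p = m.factorization p + e.factorization p := by
    rw [Nat.factorization_mul hm he]; rfl
  by_cases h1 : p ∈ m.primeFactors
  · have h2 : e.factorization p = 0 := by
      rw [← Finsupp.notMem_support_iff, Nat.support_factorization]
      exact Finset.disjoint_left.mp hc.disjoint_primeFactors h1
    have h3 : (m * e).factorization p = m.factorization p := by rw [hadd, h2, add_zero]
    rw [mpart_fact_of_ne f _ p (by rw [h3]; exact hU p h1), h3]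
  · have h2 : m.factorization p = 0 := by
      rw [← Finsupp.notMem_support_iff, Nat.support_factorization]; exact h1
    have h3 : (m * e).factorization p = e.factorization p := by rw [hadd, h2, zero_add]
    rw [h2]
    by_cases h4 : p ∈ e.primeFactors
    · exact mpart_fact_of_eq f _ p (by rw [h3]; exact hV p h4)
    · have h5 : e.factorization p = 0 := by
        rw [← Finsupp.notMem_support_iff, Nat.support_factorization]; exact h4
      by_cases h6 : f (p ^ ((m * e).factorization p)) = 0
      · exact mpart_fact_of_eq f _ p h6
      · rw [mpart_fact_of_ne f _ p h6, h3, h5]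

lemma VP_mul (f : ℕ → ℝ) {a b : ℕ} (hc : Nat.Coprime a b) (ha : a ≠ 0) (hb : b ≠ 0) :
    VP f (a * b) ↔ VP f a ∧ VP f b := by
  have hadd : ∀ p, (a * b).factorization p = a.factorization p + b.factorization p := by
    intro p; rw [Nat.factorization_mul ha hb]; rfl
  have hdis := Finset.disjoint_left.mp hc.disjoint_primeFactors
  have z : ∀ {n p : ℕ}, p ∉ n.primeFactors → n.factorization p = 0 := by
    intro n p h
    rw [← Finsupp.notMem_support_iff, Nat.support_factorization]; exact h
  unfold VP
  simp only [hadd, hc.primeFactors_mul, Finset.mem_union]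
  constructor
  · intro H
    constructor
    · intro p hp
      have := H p (Or.inl hp)
      rwa [z (hdis hp), add_zero] at this
    · intro p hp
      have := H p (Or.inr hp)
      rwa [z (fun h => hdis h hp), zero_add] at this
  · rintro ⟨H1, H2⟩ p (hp | hp)
    · rw [z (hdis hp), add_zero]; exact H1 p hp
    · rw [z (fun h => hdis h hp), zero_add]; exact H2 p hp

lemma VP_prime_pow (f : ℕ → ℝ) {p : ℕ} (hp : p.Prime) (k : ℕ) : VP f (p ^ (k + 1)) ↔ f (p ^ (k + 1)) = 0 := by
  unfold VP
  rw [Nat.primeFactors_prime_pow (by omega) hp]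
  simp [hp.factorization_self]

lemma VP_one (f : ℕ → ℝ) : VP f 1 := by intro p hp; simp at hp

lemma f_one {f : ℕ → ℝ} (hadd : IsAdditive f) : f 1 = 0 := by
  have := hadd 1 1 one_pos one_pos (Nat.coprime_one_right 1)
  simp at this
  exact this

lemma f_VP {f : ℕ → ℝ} (hadd : IsAdditive f) {e : ℕ} (he : e ≠ 0) (hV : VP f e) : f e = 0 := by
  induction e using Nat.recOnPosPrimePosCoprime with
  | zero => exact absurd rfl he
  | one => exact f_one hadd
  | prime_pow p n hp hn =>
    obtain ⟨k, rfl⟩ : ∃ k, n = k + 1 := ⟨n - 1, by omega⟩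
    exact (VP_prime_pow f hp k).mp hV
  | coprime a b ha hb hc iha ihb =>
    have ha0 : a ≠ 0 := by omega
    have hb0 : b ≠ 0 := by omega
    obtain ⟨h1, h2⟩ := (VP_mul f hc ha0 hb0).mp hV
    rw [hadd a b (by omega) (by omega) hc, iha ha0 h1, ihb hb0 h2, add_zero]

lemma f_mpart {f : ℕ → ℝ} (hadd : IsAdditive f) {n : ℕ} (hn : n ≠ 0) : f (mpart f n) = f n := by
  conv_rhs => rw [← mpart_mul_dpart f hn]
  rw [hadd _ _ (Nat.pos_of_ne_zero (mpart_ne_zero f n)) (Nat.pos_of_ne_zero (dpart_ne_zero f n))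
    (coprime_parts f n), f_VP hadd (dpart_ne_zero f n) (VP_dpart f n), add_zero]

lemma mpart_prime_mul (f : ℕ → ℝ) {p d : ℕ} (hp : p.Prime) (hf : f p = 0) (hd : d ≠ 0) (hpd : ¬ p ∣ d) :
    mpart f (p * d) = mpart f d := by
  have h0 := mpart_mul_dpart f hd
  have hc1 : Nat.Coprime p (mpart f d) := (Nat.Prime.coprime_iff_not_dvd hp).mpr
    fun h => hpd (h0 ▸ h.mul_right _)
  have hc2 : Nat.Coprime p (dpart f d) := (Nat.Prime.coprime_iff_not_dvd hp).mpr
    fun h => hpd (h0 ▸ h.mul_left _)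
  have : p * d = mpart f d * (p * dpart f d) := by
    conv_lhs => rw [← h0]
    ring
  rw [this]
  refine mpart_unique f (mpart_ne_zero f d) (mul_ne_zero hp.ne_zero (dpart_ne_zero f d))
    (Nat.Coprime.mul_right hc1.symm (coprime_parts f d)) (UP_mpart f d) ?_
  rw [VP_mul f hc2 hp.ne_zero (dpart_ne_zero f d)]
  refine ⟨?_, VP_dpart f d⟩
  have := (VP_prime_pow f hp 0)
  simp only [zero_add, pow_one] at this
  exact this.mpr hf

def gm (f : ℕ → ℝ) (m d : ℕ) : ℝ := if mpart f d = m then 1 else 0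
def vm (f : ℕ → ℝ) (m e : ℕ) : ℝ := if Nat.Coprime m e ∧ VP f e then 1 else 0

lemma uf_of_UP {f : ℕ → ℝ} {m : ℕ} (h : UP f m) : uf f m = 1 := by
  unfold uf; exact if_pos h
lemma uf_of_not_UP {f : ℕ → ℝ} {m : ℕ} (h : ¬ UP f m) : uf f m = 0 := by
  unfold uf; exact if_neg h

lemma uf_prime_pow (f : ℕ → ℝ) {p : ℕ} (hp : p.Prime) (k : ℕ) :
    uf f (p ^ (k + 1)) = if f (p ^ (k + 1)) = 0 then 0 else 1 := by
  have h : UP f (p ^ (k + 1)) ↔ f (p ^ (k + 1)) ≠ 0 := by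
    unfold UP
    rw [Nat.primeFactors_prime_pow (by omega) hp]
    simp [hp.factorization_self]
  by_cases h0 : f (p ^ (k + 1)) = 0
  · rw [if_pos h0, uf_of_not_UP (by rw [h]; exact not_not.mpr h0)]
  · rw [if_neg h0, uf_of_UP (h.mpr h0)]

lemma gm_abs_le (f : ℕ → ℝ) (m d : ℕ) : |gm f m d| ≤ 1 := by
  unfold gm; split_ifs <;> simp

lemma lam_gm_notUP {f : ℕ → ℝ} {m : ℕ} (h : ¬ UP f m) (k : ℕ) : lam (gm f m) k = 0 := by
  rw [lam_eq]
  refine Finset.sum_eq_zero fun x _ => ?_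
  have : gm f m x.2 = 0 := by
    unfold gm; rw [if_neg]; rintro rfl; exact h (UP_mpart f _)
  rw [this, mul_zero]

lemma lam_gm_ndvd {f : ℕ → ℝ} {m k : ℕ} (h : ¬ m ∣ k) : lam (gm f m) k = 0 := by
  rw [lam_eq]
  refine Finset.sum_eq_zero fun x hx => ?_
  have hx := Nat.mem_divisorsAntidiagonal.mp hx
  have : gm f m x.2 = 0 := by
    unfold gm; rw [if_neg]; rintro rfl
    apply h
    have h2 : x.2 ≠ 0 := by
      intro h0; rw [h0, mul_zero] at hx; exact hx.2 hx.1.symm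
    rw [← hx.1]
    refine Dvd.dvd.mul_left ?_ _
    exact ⟨_, (mpart_mul_dpart f h2).symm⟩
  rw [this, mul_zero]

lemma lam_gm_mul {f : ℕ → ℝ} {m : ℕ} (hm : m ≠ 0) (hU : UP f m) (j : ℕ) :
    lam (gm f m) (m * j) = lam (vm f m) j := by
  rw [lam_eq, lam_eq]
  symm
  refine Finset.sum_of_injOn (fun x : ℕ × ℕ => (x.1, m * x.2)) ?_ ?_ ?_ ?_
  · intro a _ b _ hab
    simp only [Prod.mk.injEq] at hab
    exact Prod.ext hab.1 (Nat.eq_of_mul_eq_mul_left (Nat.pos_of_ne_zero hm) hab.2)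
  · intro x hx
    have hx := Nat.mem_divisorsAntidiagonal.mp (Finset.mem_coe.mp hx)
    refine Finset.mem_coe.mpr (Nat.mem_divisorsAntidiagonal.mpr ⟨?_, mul_ne_zero hm hx.2⟩)
    rw [← hx.1]; ring
  · intro x hx hni
    have hx := Nat.mem_divisorsAntidiagonal.mp hx
    have h2 : x.2 ≠ 0 := by
      intro h0; rw [h0, mul_zero] at hx; exact hx.2 hx.1.symm
    have : gm f m x.2 = 0 := by
      unfold gm; rw [if_neg]; intro hmp
      apply hni
      have hd := mpart_mul_dpart f h2
      rw [hmp] at hd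
      refine ⟨(x.1, dpart f x.2), Finset.mem_coe.mpr (Nat.mem_divisorsAntidiagonal.mpr ⟨?_, ?_⟩), ?_⟩
      · apply Nat.eq_of_mul_eq_mul_left (Nat.pos_of_ne_zero hm)
        rw [← hx.1]
        conv_rhs => rw [← hd]
        ring
      · rintro rfl; simp at hx
      · exact Prod.ext rfl hd
    rw [this, mul_zero]
  · intro x hx
    have hx := Nat.mem_divisorsAntidiagonal.mp hx
    have h2 : x.2 ≠ 0 := by
      intro h0; rw [h0, mul_zero] at hx; exact hx.2 hx.1.symm
    congr 1
    unfold gm vm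
    refine if_congr ?_ rfl rfl
    constructor
    · rintro ⟨hc, hV⟩
      exact mpart_unique f hm h2 hc hU hV
    · intro h
      have h3 : m * x.2 ≠ 0 := mul_ne_zero hm h2
      have hd := mpart_mul_dpart f h3
      have hc := coprime_parts f (m * x.2)
      have hv := VP_dpart f (m * x.2)
      have hh : mpart f (m * x.2) = m := h
      rw [hh] at hd hc
      have := Nat.eq_of_mul_eq_mul_left (Nat.pos_of_ne_zero hm) hd
      rw [this] at hc hv
      exact ⟨hc, hv⟩

lemma vm_mult (f : ℕ → ℝ) (m : ℕ) : (toAF (vm f m)).IsMultiplicative := by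
  rw [ArithmeticFunction.IsMultiplicative.iff_ne_zero]
  constructor
  · rw [toAF_apply _ one_ne_zero]
    unfold vm
    rw [if_pos ⟨Nat.coprime_one_right m, VP_one f⟩]
  · intro a b ha hb hc
    rw [toAF_apply _ (mul_ne_zero ha hb), toAF_apply _ ha, toAF_apply _ hb]
    unfold vm
    by_cases h1 : Nat.Coprime m a ∧ VP f a
    · by_cases h2 : Nat.Coprime m b ∧ VP f b
      · rw [if_pos h1, if_pos h2, if_pos ⟨Nat.Coprime.mul_right h1.1 h2.1, (VP_mul f hc ha hb).mpr ⟨h1.2, h2.2⟩⟩, one_mul]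
      · rw [if_neg h2, if_neg, mul_zero]
        rintro ⟨h3, h4⟩
        exact h2 ⟨h3.coprime_mul_left_right, ((VP_mul f hc ha hb).mp h4).2⟩
    · rw [if_neg h1, if_neg, zero_mul]
      rintro ⟨h3, h4⟩
      exact h1 ⟨h3.coprime_mul_right_right, ((VP_mul f hc ha hb).mp h4).1⟩

lemma lam_vm_mult (f : ℕ → ℝ) (m : ℕ) : (lam (vm f m)).IsMultiplicative :=
  (ArithmeticFunction.isMultiplicative_moebius.intCast).mul (vm_mult f m)

lemma lam_prime_pow_succ (G : ℕ → ℝ) {p : ℕ} (hp : p.Prime) (e : ℕ) :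
    lam G (p ^ (e + 1)) = G (p ^ (e + 1)) - G (p ^ e) := by
  have h1 := sum_divisors_lam G (pow_ne_zero (e + 1) hp.ne_zero)
  have h2 := sum_divisors_lam G (pow_ne_zero e hp.ne_zero)
  rw [Nat.sum_divisors_prime_pow hp] at h1 h2
  rw [Finset.sum_range_succ, h2] at h1
  linarith

lemma summable_of_zero_one {p : ℕ} (hp : p.Prime) (a : ℕ → ℝ) (ha : ∀ e, 0 ≤ a e ∧ a e ≤ 1) :
    Summable (fun e : ℕ => a e / (p : ℝ) ^ e) := by
  have hp2 : (2 : ℝ) ≤ p := by exact_mod_cast hp.two_le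
  have hg : Summable (fun e : ℕ => (1 / (p : ℝ)) ^ e) :=
    summable_geometric_of_lt_one (by positivity) (by rw [div_lt_one (by linarith)]; linarith)
  refine Summable.of_nonneg_of_le (fun e => div_nonneg (ha e).1 (by positivity)) (fun e => ?_) hg
  rw [one_div_pow]
  exact div_le_div_of_nonneg_right (ha e).2 (by positivity)

lemma vm_01 (f : ℕ → ℝ) (m e : ℕ) : 0 ≤ vm f m e ∧ vm f m e ≤ 1 := by
  unfold vm; split_ifs <;> norm_num

lemma uf_01 (f : ℕ → ℝ) (e : ℕ) : 0 ≤ uf f e ∧ uf f e ≤ 1 := by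
  by_cases h : UP f e
  · rw [uf_of_UP h]; norm_num
  · rw [uf_of_not_UP h]; norm_num

lemma local_factor (f : ℕ → ℝ) (m : ℕ) {p : ℕ} (hp : p.Prime) :
    ∑' e : ℕ, lam (vm f m) (p ^ e) / ((p ^ e : ℕ) : ℝ) = (1 - 1 / (p : ℝ)) * ∑' e : ℕ, vm f m (p ^ e) / (p : ℝ) ^ e := by
  have hp2 : (2 : ℝ) ≤ p := by exact_mod_cast hp.two_le
  have hs := summable_of_zero_one hp (fun e => vm f m (p ^ e)) (fun e => vm_01 f m _)
  have hs1 := (summable_nat_add_iff (f := fun e : ℕ => vm f m (p ^ e) / (p : ℝ) ^ e) 1).mpr hs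
  have hpt : ∀ e : ℕ, lam (vm f m) (p ^ (e + 1)) / ((p ^ (e + 1) : ℕ) : ℝ) =
      vm f m (p ^ (e + 1)) / (p : ℝ) ^ (e + 1) - (1 / (p : ℝ)) * (vm f m (p ^ e) / (p : ℝ) ^ e) := by
    intro e
    rw [lam_prime_pow_succ _ hp]
    push_cast
    field_simp
    ring
  have hs2 : Summable (fun e : ℕ => lam (vm f m) (p ^ (e + 1)) / ((p ^ (e + 1) : ℕ) : ℝ)) := by
    simp only [hpt]
    exact hs1.sub (hs.mul_left _)
  have hs3 := (summable_nat_add_iff (f := fun e : ℕ => lam (vm f m) (p ^ e) / ((p ^ e : ℕ) : ℝ)) 1).mp hs2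
  rw [hs3.tsum_eq_zero_add]
  simp only [hpt]
  rw [hs1.tsum_sub (hs.mul_left _), tsum_mul_left]
  have h0 : lam (vm f m) (p ^ 0) / ((p ^ 0 : ℕ) : ℝ) = vm f m (p ^ 0) / (p : ℝ) ^ 0 := by
    rw [pow_zero, (lam_vm_mult f m).1, ← (vm_mult f m).1, toAF_apply _ one_ne_zero]
    simp
  rw [h0]
  have := hs.tsum_eq_zero_add
  linear_combination (-1 : ℝ) * this

lemma vm_one (f : ℕ → ℝ) (m : ℕ) : vm f m 1 = 1 := by
  rw [← toAF_apply (vm f m) one_ne_zero, (vm_mult f m).1]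

lemma local_dvd (f : ℕ → ℝ) (m : ℕ) {p : ℕ} (hp : p.Prime) (h : p ∣ m) :
    ∑' e : ℕ, vm f m (p ^ e) / (p : ℝ) ^ e = 1 := by
  rw [tsum_eq_single 0]
  · simp [vm_one]
  · intro e he
    have : vm f m (p ^ e) = 0 := by
      unfold vm; rw [if_neg]
      rintro ⟨hc, _⟩
      have h1 := Nat.Coprime.coprime_dvd_left h hc
      have h2 := (Nat.coprime_pow_right_iff (Nat.pos_of_ne_zero he) p p).mp h1
      rw [Nat.coprime_self] at h2
      exact hp.ne_one h2
    rw [this, zero_div]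

lemma local_ndvd (f : ℕ → ℝ) (m : ℕ) {p : ℕ} (hp : p.Prime) (h : ¬ p ∣ m) :
    (1 - 1 / (p : ℝ)) * ∑' e : ℕ, vm f m (p ^ e) / (p : ℝ) ^ e = 1 - wp f p := by
  have hp2 : (2 : ℝ) ≤ p := by exact_mod_cast hp.two_le
  have hs := summable_of_zero_one hp (fun e => vm f m (p ^ e)) (fun e => vm_01 f m _)
  have hg : Summable (fun e : ℕ => (1 : ℝ) / (p : ℝ) ^ e) :=
    summable_of_zero_one hp (fun e => 1) (fun e => by norm_num)
  have hg1 := (summable_nat_add_iff (f := fun e : ℕ => (1 : ℝ) / (p : ℝ) ^ e) 1).mpr hg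
  have hu := summable_of_zero_one hp (fun e => uf f (p ^ e)) (fun e => uf_01 f _)
  have hu1 := (summable_nat_add_iff (f := fun e : ℕ => uf f (p ^ e) / (p : ℝ) ^ e) 1).mpr hu
  have hpt : ∀ e : ℕ, vm f m (p ^ (e + 1)) / (p : ℝ) ^ (e + 1) =
      1 / (p : ℝ) ^ (e + 1) - uf f (p ^ (e + 1)) / (p : ℝ) ^ (e + 1) := by
    intro e
    rw [← sub_div]
    congr 1
    rw [uf_prime_pow f hp]
    have hc : Nat.Coprime m (p ^ (e + 1)) :=
      Nat.Coprime.pow_right _ ((Nat.Prime.coprime_iff_not_dvd hp).mpr h).symm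
    unfold vm
    by_cases h0 : f (p ^ (e + 1)) = 0
    · rw [if_pos ⟨hc, (VP_prime_pow f hp e).mpr h0⟩, if_pos h0]; ring
    · rw [if_neg (fun hh => h0 ((VP_prime_pow f hp e).mp hh.2)), if_neg h0]; ring
  rw [hs.tsum_eq_zero_add]
  simp only [hpt]
  rw [hg1.tsum_sub hu1, pow_zero, vm_one]
  have hgeo : ∑' e : ℕ, (1 : ℝ) / (p : ℝ) ^ e = (1 - 1 / (p : ℝ))⁻¹ := by
    rw [← tsum_geometric_of_lt_one (by positivity) (by rw [div_lt_one (by linarith)]; linarith)]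
    exact tsum_congr fun e => by rw [one_div_pow]
  have h1 := hg.tsum_eq_zero_add
  rw [hgeo] at h1
  have hne : (1 - 1 / (p : ℝ)) ≠ 0 := by
    have : 1 / (p : ℝ) < 1 := by rw [div_lt_one (by linarith)]; linarith
    linarith
  have h2 : (1 - 1 / (p : ℝ)) * (1 - 1 / (p : ℝ))⁻¹ = 1 := mul_inv_cancel₀ hne
  unfold wp
  rw [h1] at h2
  simp only [pow_zero] at h2 ⊢
  linear_combination h2

lemma one_sub_wp_pos (f : ℕ → ℝ) {p : ℕ} (hp : p.Prime) : 0 < 1 - wp f p := by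
  have hp2 : (2 : ℝ) ≤ p := by exact_mod_cast hp.two_le
  rw [← local_ndvd f 1 hp (fun h => hp.ne_one (Nat.dvd_one.mp h))]
  have hs := summable_of_zero_one hp (fun e => vm f 1 (p ^ e)) (fun e => vm_01 f 1 _)
  have h1 := hs.le_tsum 0 (fun e _ => div_nonneg (vm_01 f 1 _).1 (by positivity))
  simp only [pow_zero, vm_one] at h1
  have : 1 / (p : ℝ) < 1 := by rw [div_lt_one (by linarith)]; linarith
  refine mul_pos (by linarith) (by linarith)

lemma gm_shift (f : ℕ → ℝ) (m : ℕ) : ∀ p, p.Prime → ¬ (f p ≠ 0) → ∀ d, d ≠ 0 → ¬ p ∣ d →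
    gm f m (p * d) = gm f m d := by
  intro p hp hf d hd hpd
  unfold gm
  rw [mpart_prime_mul f hp (not_not.mp hf) hd hpd]

lemma summable_lam {P : ℕ → Prop} (hs : Summable (fun k : ℕ => bP P k / k)) {G : ℕ → ℝ}
    (h : ∀ k, |lam G k| ≤ bP P k) : Summable (fun k : ℕ => lam G k / k) := by
  refine Summable.of_norm_bounded hs fun k => ?_
  rw [Real.norm_eq_abs, abs_div, Nat.abs_cast]
  exact div_le_div_of_nonneg_right (h k) (by positivity)

lemma summable_lam_vm {f : ℕ → ℝ} (hs : Summable (fun k : ℕ => bP (fun p => f p ≠ 0) k / k))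
    {m : ℕ} (hm : m ≠ 0) (hU : UP f m) : Summable (fun j : ℕ => lam (vm f m) j / j) := by
  have h1 := summable_lam hs (lam_bound _ (gm f m) (gm_abs_le f m) (gm_shift f m))
  have hinj : Function.Injective (fun j : ℕ => m * j) :=
    fun a b h => Nat.eq_of_mul_eq_mul_left (Nat.pos_of_ne_zero hm) h
  have h2 := (h1.comp_injective hinj).mul_left (m : ℝ)
  refine h2.congr fun j => ?_
  have hm' : (m : ℝ) ≠ 0 := by exact_mod_cast hm
  simp only [Function.comp]
  rw [lam_gm_mul hm hU]
  push_cast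
  by_cases hj : (j : ℝ) = 0
  · simp [hj]
  · field_simp

lemma hasProd_vm {f : ℕ → ℝ} (hs : Summable (fun k : ℕ => bP (fun p => f p ≠ 0) k / k))
    {m : ℕ} (hm : m ≠ 0) (hU : UP f m) :
    HasProd (fun p : Nat.Primes => if (p : ℕ) ∣ m then 1 - 1 / ((p : ℕ) : ℝ) else 1 - wp f p)
      (∑' j : ℕ, lam (vm f m) j / j) := by
  have h := EulerProduct.eulerProduct_hasProd (f := fun j : ℕ => lam (vm f m) j / (j : ℝ))
    (by rw [(lam_vm_mult f m).1]; simp)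
    (by intro a b hab; rw [(lam_vm_mult f m).2 hab]; push_cast; rw [mul_div_mul_comm])
    (summable_lam_vm hs hm hU).norm (by simp)
  have heq : (fun p : Nat.Primes => if (p : ℕ) ∣ m then 1 - 1 / ((p : ℕ) : ℝ) else 1 - wp f p) =
      fun p : Nat.Primes => ∑' e : ℕ, lam (vm f m) ((p : ℕ) ^ e) / (((p : ℕ) ^ e : ℕ) : ℝ) := by
    funext p
    rw [local_factor f m p.2]
    by_cases hd : (p : ℕ) ∣ m
    · rw [if_pos hd, local_dvd f m p.2 hd, mul_one]
    · rw [if_neg hd, local_ndvd f m p.2 hd]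
  rw [heq]
  exact h

lemma UP_one (f : ℕ → ℝ) : UP f 1 := by intro p hp; simp at hp

lemma tsum_gm {f : ℕ → ℝ} (hs : Summable (fun k : ℕ => bP (fun p => f p ≠ 0) k / k))
    {m : ℕ} (hm : m ≠ 0) :
    ∑' k : ℕ, lam (gm f m) k / k = (∏' p : Nat.Primes, (1 - wp f (p : ℕ))) * (hf f m / m) := by
  by_cases hU : UP f m
  swap
  · simp only [lam_gm_notUP hU, hf, uf_of_not_UP hU]; simp
  have hinj : Function.Injective (fun j : ℕ => m * j) :=
    fun a b h => Nat.eq_of_mul_eq_mul_left (Nat.pos_of_ne_zero hm) h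
  have hm' : (m : ℝ) ≠ 0 := by exact_mod_cast hm
  have h1 : ∑' k : ℕ, lam (gm f m) k / k = ∑' j : ℕ, (1 / (m : ℝ)) * (lam (vm f m) j / j) := by
    rw [← hinj.tsum_eq (f := fun k : ℕ => lam (gm f m) k / (k : ℝ))]
    · refine tsum_congr fun j => ?_
      rw [lam_gm_mul hm hU]
      push_cast
      rw [← mul_div_mul_comm, one_mul]
    · intro k hk
      by_contra hn
      apply hk
      have : ¬ m ∣ k := fun ⟨j, hj⟩ => hn ⟨j, hj.symm⟩
      simp only [lam_gm_ndvd this, zero_div]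
  rw [h1, tsum_mul_left]
  have hP1 : HasProd (fun p : Nat.Primes => 1 - wp f (p : ℕ)) (∑' j : ℕ, lam (vm f 1) j / j) := by
    have := hasProd_vm hs one_ne_zero (UP_one f)
    convert this using 2 with p
    rw [if_neg (fun h => p.2.ne_one (Nat.dvd_one.mp h))]
  have hPm := hasProd_vm hs hm hU
  set c : ℕ → ℝ := fun p => (1 - 1 / (p : ℝ)) / (1 - wp f p) with hc
  have hfin : HasProd (fun p : Nat.Primes => if (p : ℕ) ∣ m then c p else 1)
      (∏ p ∈ (m.primeFactors.subtype Nat.Prime : Finset Nat.Primes), if (p : ℕ) ∣ m then c p else 1) := by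
    apply hasProd_prod_of_ne_finset_one
    intro p hp
    rw [if_neg]
    intro hd
    apply hp
    exact Finset.mem_subtype.mpr (Nat.mem_primeFactors.mpr ⟨p.2, hd, hm⟩)
  have hval : (∏ p ∈ (m.primeFactors.subtype Nat.Prime : Finset Nat.Primes), if (p : ℕ) ∣ m then c p else 1)
      = ∏ p ∈ m.primeFactors, c p := by
    rw [Finset.prod_subtype_of_mem (fun p : ℕ => if p ∣ m then c p else 1)
      (fun p hp => Nat.prime_of_mem_primeFactors hp)]
    refine Finset.prod_congr rfl fun p hp => ?_
    rw [if_pos (Nat.dvd_of_mem_primeFactors hp)]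
  rw [hval] at hfin
  have hmul := hP1.mul hfin
  have heq : (fun p : Nat.Primes => (1 - wp f (p : ℕ)) * (if (p : ℕ) ∣ m then c p else 1)) =
      fun p : Nat.Primes => if (p : ℕ) ∣ m then 1 - 1 / ((p : ℕ) : ℝ) else 1 - wp f p := by
    funext p
    split_ifs
    · have := (one_sub_wp_pos f p.2).ne'
      simp only [hc]
      field_simp
    · rw [mul_one]
  rw [heq] at hmul
  rw [hPm.unique hmul, hP1.tprod_eq, hf, uf_of_UP hU]
  ring

def Gy (f : ℕ → ℝ) (y : ℝ) (n : ℕ) : ℝ := if f n ≤ y then 1 else 0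

def lamc (f : ℕ → ℝ) (y : ℝ) (k m : ℕ) : ℝ := if 1 ≤ m ∧ f m ≤ y then lam (gm f m) k else 0

lemma lam_gm_not_mem {f : ℕ → ℝ} {m k : ℕ} (h : m ∉ k.divisors) : lam (gm f m) k = 0 := by
  by_cases hk : k = 0
  · rw [hk]; exact ArithmeticFunction.map_zero
  · exact lam_gm_ndvd fun hd => h (Nat.mem_divisors.mpr ⟨hd, hk⟩)

lemma lamc_not_mem {f : ℕ → ℝ} {y : ℝ} {m k : ℕ} (h : m ∉ k.divisors) : lamc f y k m = 0 := by
  unfold lamc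
  rw [lam_gm_not_mem h, ite_self]

lemma mpart_mem {f : ℕ → ℝ} {k : ℕ} {x : ℕ × ℕ} (hx : x ∈ k.divisorsAntidiagonal) :
    x.2 ≠ 0 ∧ mpart f x.2 ∈ k.divisors := by
  have hx := Nat.mem_divisorsAntidiagonal.mp hx
  have h2 : x.2 ≠ 0 := by
    intro h0; rw [h0, mul_zero] at hx; exact hx.2 hx.1.symm
  refine ⟨h2, Nat.mem_divisors.mpr ⟨?_, hx.2⟩⟩
  rw [← hx.1]
  exact Dvd.dvd.mul_left ⟨_, (mpart_mul_dpart f h2).symm⟩ _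

lemma lam_Gy {f : ℕ → ℝ} (hadd : IsAdditive f) (y : ℝ) (k : ℕ) :
    lam (Gy f y) k = ∑ m ∈ k.divisors, lamc f y k m := by
  have h1 : ∀ m, lamc f y k m = ∑ x ∈ k.divisorsAntidiagonal,
      (ArithmeticFunction.moebius x.1 : ℝ) * (if 1 ≤ m ∧ f m ≤ y then gm f m x.2 else 0) := by
    intro m
    unfold lamc
    by_cases h : 1 ≤ m ∧ f m ≤ y
    · simp only [if_pos h]; exact lam_eq _ _
    · simp only [if_neg h, mul_zero, Finset.sum_const_zero]
  simp only [h1]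
  rw [Finset.sum_comm, lam_eq]
  refine Finset.sum_congr rfl fun x hx => ?_
  obtain ⟨h2, hm⟩ := mpart_mem (f := f) hx
  rw [← Finset.mul_sum, Finset.sum_eq_single_of_mem _ hm]
  · congr 1
    unfold Gy gm
    by_cases h : f x.2 ≤ y
    · rw [if_pos h, if_pos ⟨Nat.pos_of_ne_zero (mpart_ne_zero f _), by rwa [f_mpart hadd h2]⟩, if_pos rfl]
    · rw [if_neg h, if_neg]
      rintro ⟨_, h3⟩
      rw [f_mpart hadd h2] at h3
      exact h h3
  · intro m _ hne
    have hg : gm f m x.2 = 0 := by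
      unfold gm; rw [if_neg (fun h => hne h.symm)]
    rw [hg, ite_self]

lemma sum_abs_lamc (f : ℕ → ℝ) (y : ℝ) (k : ℕ) :
    ∑ m ∈ k.divisors, |lamc f y k m| ≤ bP (fun p => f p ≠ 0) k := by
  have h0 : ∀ m, |lamc f y k m| ≤ |lam (gm f m) k| := by
    intro m; unfold lamc; split_ifs
    · exact le_rfl
    · rw [abs_zero]; exact abs_nonneg _
  refine (Finset.sum_le_sum fun m _ => h0 m).trans ?_
  rcases not_good_cases (fun p => f p ≠ 0) k with rfl | h | ⟨p, k', hp, hpk, hk, hPp, rfl⟩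
  · simp [bP_zero]
  · rw [h]
    refine le_trans ?_ (sum_abs_moebius_le k)
    calc ∑ m ∈ k.divisors, |lam (gm f m) k|
        ≤ ∑ m ∈ k.divisors, ∑ x ∈ k.divisorsAntidiagonal,
          |(ArithmeticFunction.moebius x.1 : ℝ)| * gm f m x.2 := by
          refine Finset.sum_le_sum fun m _ => ?_
          rw [lam_eq]
          refine (Finset.abs_sum_le_sum_abs _ _).trans (le_of_eq ?_)
          refine Finset.sum_congr rfl fun x _ => ?_
          rw [abs_mul, abs_of_nonneg (a := gm f m x.2)]
          unfold gm; split_ifs <;> norm_num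
      _ = _ := by
          rw [Finset.sum_comm]
          refine Finset.sum_congr rfl fun x hx => ?_
          obtain ⟨h2, hm⟩ := mpart_mem (f := f) hx
          rw [← Finset.mul_sum, Finset.sum_eq_single_of_mem _ hm]
          · unfold gm; rw [if_pos rfl, mul_one]
          · intro m _ hne
            unfold gm
            rw [if_neg (fun h => hne h.symm)]
  · rw [Finset.sum_eq_zero]
    · exact bP_nonneg _ _
    · intro m _
      rw [lam_vanish _ hp hpk hk (gm_shift f m p hp hPp), abs_zero]

lemma tsum_Gy {f : ℕ → ℝ} (hadd : IsAdditive f)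
    (hs : Summable (fun k : ℕ => bP (fun p => f p ≠ 0) k / k)) (y : ℝ) :
    ∑' k : ℕ, lam (Gy f y) k / k = Flim f y := by
  have hfs : ∀ k : ℕ, ∑' m : ℕ, lamc f y k m / (k : ℝ) = lam (Gy f y) k / k := by
    intro k
    rw [tsum_eq_sum (s := k.divisors), lam_Gy hadd, Finset.sum_div]
    intro m hm
    rw [lamc_not_mem hm, zero_div]
  have hsum : Summable (Function.uncurry fun k m : ℕ => lamc f y k m / (k : ℝ)) := by
    apply Summable.of_norm
    rw [summable_prod_of_nonneg (fun _ => norm_nonneg _)]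
    constructor
    · intro k
      refine summable_of_ne_finset_zero (s := k.divisors) fun m hm => ?_
      simp only [Function.uncurry, lamc_not_mem hm, zero_div, norm_zero]
    · refine Summable.of_nonneg_of_le (fun k => tsum_nonneg fun m => norm_nonneg _) (fun k => ?_) hs
      rw [tsum_eq_sum (s := k.divisors)]
      · simp only [Function.uncurry, Real.norm_eq_abs, abs_div, Nat.abs_cast]
        rw [← Finset.sum_div]
        exact div_le_div_of_nonneg_right (sum_abs_lamc f y k) (by positivity)
      · intro m hm
        simp only [Function.uncurry, lamc_not_mem hm, zero_div, norm_zero]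
  have hcomm := hsum.tsum_comm
  rw [← tsum_congr hfs, ← hcomm]
  unfold Flim
  rw [← tsum_mul_left]
  refine tsum_congr fun m => ?_
  by_cases h : 1 ≤ m ∧ f m ≤ y
  · rw [if_pos h]
    simp only [lamc, if_pos h]
    exact tsum_gm hs (by omega)
  · rw [if_neg h]
    simp only [lamc, if_neg h, zero_div, tsum_zero, mul_zero]

lemma Gy_shift {f : ℕ → ℝ} (hadd : IsAdditive f) (y : ℝ) : ∀ p, p.Prime → ¬ (f p ≠ 0) → ∀ d, d ≠ 0 → ¬ p ∣ d →
    Gy f y (p * d) = Gy f y d := by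
  intro p hp hf d hd hpd
  unfold Gy
  rw [hadd p d hp.pos (Nat.pos_of_ne_zero hd) ((Nat.Prime.coprime_iff_not_dvd hp).mpr hpd), not_not.mp hf, zero_add]

lemma Gy_abs_le (f : ℕ → ℝ) (y : ℝ) (d : ℕ) : |Gy f y d| ≤ 1 := by
  unfold Gy; split_ifs <;> simp

lemma Fx_eq (f : ℕ → ℝ) {x : ℝ} (hx : 0 < x) (y : ℝ) :
    Fx f x y = ∑' k : ℕ, lam (Gy f y) k * (((⌊x⌋₊ / k : ℕ) : ℝ) / x) := by
  have h1 : ((((Finset.Icc 1 ⌊x⌋₊).filter (fun n => f n ≤ y)).card : ℕ) : ℝ) = ∑ n ∈ Finset.Ioc 0 ⌊x⌋₊, Gy f y n := by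
    rw [Finset.card_filter]
    push_cast
    rfl
  unfold Fx
  rw [h1, sum_Ioc_lam, tsum_eq_sum (s := Finset.Ioc 0 ⌊x⌋₊), Finset.sum_div]
  · exact Finset.sum_congr rfl fun k _ => by rw [mul_div_assoc]
  · intro k hk
    rw [Finset.mem_Ioc] at hk
    by_cases hk0 : k = 0
    · rw [hk0, ArithmeticFunction.map_zero, zero_mul]
    · rw [Nat.div_eq_of_lt (by omega)]; simp

lemma floor_err {x : ℝ} (hx : 0 < x) {k : ℕ} (hk : k ≠ 0) :
    |((⌊x⌋₊ / k : ℕ) : ℝ) / x - 1 / k| ≤ 1 / x ∧ |((⌊x⌋₊ / k : ℕ) : ℝ) / x - 1 / k| ≤ 1 / k := by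
  have hk' : (0 : ℝ) < k := by exact_mod_cast Nat.pos_of_ne_zero hk
  have he : ⌊x⌋₊ / k = ⌊x / k⌋₊ := (Nat.floor_div_natCast x k).symm
  have hxk : 0 ≤ x / k := by positivity
  have h1 := Nat.floor_le hxk
  have h2 := Nat.lt_floor_add_one (x / k)
  rw [he]
  have h3 : (⌊x / k⌋₊ : ℝ) / x - 1 / k = ((⌊x / k⌋₊ : ℝ) - x / k) / x := by
    field_simp
  have hd : (x / k) / x = 1 / k := by field_simp
  have h0 : (0 : ℝ) ≤ (⌊x / k⌋₊ : ℝ) := by positivity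
  rw [h3, abs_div, abs_of_pos hx]
  constructor
  · apply div_le_div_of_nonneg_right _ hx.le
    rw [abs_le]; constructor <;> linarith
  · rw [← hd]
    apply div_le_div_of_nonneg_right _ hx.le
    rw [abs_le]; constructor <;> linarith

lemma main_err {f : ℕ → ℝ} (hadd : IsAdditive f)
    (hs : Summable (fun k : ℕ => bP (fun p => f p ≠ 0) k / k)) {x : ℝ} (hx : 0 < x) (y : ℝ) :
    |Fx f x y - Flim f y| ≤ (∑' k : ℕ, bP (fun p => f p ≠ 0) k / k) * (1 / √x) +
      ∑' k : ℕ, (if √x < (k : ℝ) then bP (fun p => f p ≠ 0) k / k else 0) := by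
  set P : ℕ → Prop := fun p => f p ≠ 0 with hP
  have hb := lam_bound P (Gy f y) (Gy_abs_le f y) (Gy_shift hadd y)
  have hs1 := summable_lam hs hb
  have hs2 : Summable (fun k : ℕ => lam (Gy f y) k * (((⌊x⌋₊ / k : ℕ) : ℝ) / x)) := by
    refine summable_of_ne_finset_zero (s := Finset.Ioc 0 ⌊x⌋₊) fun k hk => ?_
    rw [Finset.mem_Ioc] at hk
    by_cases hk0 : k = 0
    · rw [hk0, ArithmeticFunction.map_zero, zero_mul]
    · rw [Nat.div_eq_of_lt (by omega)]; simp
  rw [← tsum_Gy hadd hs, Fx_eq f hx, ← hs2.tsum_sub hs1]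
  have hs3 : Summable (fun k : ℕ => if √x < (k : ℝ) then bP P k / k else 0) := by
    refine Summable.of_nonneg_of_le (fun k => ?_) (fun k => ?_) hs
    · split_ifs
      · exact div_nonneg (bP_nonneg _ _) (by positivity)
      · exact le_rfl
    · split_ifs
      · exact le_rfl
      · exact div_nonneg (bP_nonneg _ _) (by positivity)
  rw [← tsum_mul_right, ← (hs.mul_right _).tsum_add hs3]
  have hsx : 0 < √x := Real.sqrt_pos.mpr hx
  have hxx : √x * √x = x := Real.mul_self_sqrt hx.le
  rw [← Real.norm_eq_abs]
  refine tsum_of_norm_bounded ((hs.mul_right (1 / √x)).add hs3).hasSum fun k => ?_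
  rw [Real.norm_eq_abs]
  by_cases hk : k = 0
  · rw [hk, ArithmeticFunction.map_zero]
    simp [hsx.le]
  have hk' : (0 : ℝ) < k := by exact_mod_cast Nat.pos_of_ne_zero hk
  obtain ⟨e1, e2⟩ := floor_err hx hk
  have h1 : lam (Gy f y) k * (((⌊x⌋₊ / k : ℕ) : ℝ) / x) - lam (Gy f y) k / k =
      lam (Gy f y) k * (((⌊x⌋₊ / k : ℕ) : ℝ) / x - 1 / k) := by ring
  rw [h1, abs_mul]
  have hbn := bP_nonneg P k
  split_ifs with hlt
  · have : |lam (Gy f y) k| * |((⌊x⌋₊ / k : ℕ) : ℝ) / x - 1 / k| ≤ bP P k * (1 / k) :=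
      mul_le_mul (hb k) e2 (abs_nonneg _) hbn
    have h5 : 0 ≤ bP P k / k * (1 / √x) := by positivity
    rw [mul_one_div] at this
    linarith
  · have h4 : 1 / x ≤ 1 / k * (1 / √x) := by
      rw [one_div_mul_one_div]
      apply one_div_le_one_div_of_le (by positivity)
      calc (k : ℝ) * √x ≤ √x * √x := mul_le_mul_of_nonneg_right (not_lt.mp hlt) hsx.le
        _ = x := hxx
    have : |lam (Gy f y) k| * |((⌊x⌋₊ / k : ℕ) : ℝ) / x - 1 / k| ≤ bP P k * (1 / k * (1 / √x)) :=
      mul_le_mul (hb k) (e1.trans h4) (abs_nonneg _) hbn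
    rw [add_zero]
    refine this.trans (le_of_eq ?_)
    ring

lemma alphaf_eq (f : ℕ → ℝ) (z : ℝ) : alphaf f z =
    ∑' p : Nat.Primes, if z < ((p : ℕ) : ℝ) then (if f (p : ℕ) ≠ 0 then (1 : ℝ) / ((p : ℕ) : ℝ) else 0) else 0 := by
  unfold alphaf
  refine tsum_congr fun p => ?_
  have h := uf_prime_pow f p.2 0
  rw [zero_add, pow_one] at h
  have h2 : uf f (p : ℕ) / ((p : ℕ) : ℝ) = if f (p : ℕ) ≠ 0 then (1 : ℝ) / ((p : ℕ) : ℝ) else 0 := by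
    rw [h]
    by_cases h0 : f (p : ℕ) = 0
    · rw [if_pos h0, if_neg (not_not.mpr h0), zero_div]
    · rw [if_neg h0, if_pos h0]
  rw [h2]

lemma alphaf_nonneg (f : ℕ → ℝ) (z : ℝ) : 0 ≤ alphaf f z := by
  unfold alphaf
  refine tsum_nonneg fun p => ?_
  split_ifs
  · exact div_nonneg (uf_01 f _).1 (by positivity)
  · exact le_rfl

lemma betaf_nonneg (f : ℕ → ℝ) {y : ℝ} (hy : 1 ≤ y) : 0 ≤ betaf f y := by
  unfold betaf
  refine mul_nonneg (one_div_nonneg.mpr (Real.log_nonneg hy)) ?_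
  refine intervalIntegral.integral_nonneg hy fun t ht => ?_
  exact div_nonneg (alphaf_nonneg f t) (by linarith [ht.1])

lemma inv_sqrt_le {x : ℝ} (hx : 1 < x) : 1 / √x ≤ 1 / Real.log x ^ ((1 : ℝ) / 6) := by
  have hl : 0 < Real.log x := Real.log_pos hx
  apply one_div_le_one_div_of_le (Real.rpow_pos_of_pos hl _)
  have h1 : Real.log x ≤ x := by linarith [Real.log_le_sub_one_of_pos (by linarith : 0 < x)]
  calc Real.log x ^ ((1 : ℝ) / 6) ≤ x ^ ((1 : ℝ) / 6) := Real.rpow_le_rpow hl.le h1 (by norm_num)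
    _ ≤ x ^ ((1 : ℝ) / 2) := Real.rpow_le_rpow_of_exponent_le hx.le (by norm_num)
    _ = √x := (Real.sqrt_eq_rpow x).symm

lemma main_thm (f : ℕ → ℝ) (hadd : IsAdditive f)
    (hfin : Summable (fun p : Nat.Primes => if f (p : ℕ) ≠ 0 then (1 : ℝ) / ((p : ℕ) : ℝ) else 0)) :
    ∃ C : ℝ, 0 < C ∧ ∀ x : ℝ, 2 ≤ x → ∀ y : ℝ,
      |Fx f x y - Flim f y| ≤
        C * (alphaf f (x ^ (1 / Real.log (Real.log x)))
          + betaf f (Real.sqrt x) ^ ((1:ℝ)/4)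
          + 1 / Real.log x ^ ((1:ℝ)/6)) := by
  obtain ⟨hs, C, hC, hT⟩ := tail_bound (fun p => f p ≠ 0) (hfin.congr fun p => by congr)
  set B := ∑' k : ℕ, bP (fun p => f p ≠ 0) k / k with hB
  have hB0 : 0 ≤ B := tsum_nonneg fun k => div_nonneg (bP_nonneg _ _) (by positivity)
  refine ⟨2 * B + C + 1, by linarith, fun x hx y => ?_⟩
  have hx0 : 0 < x := by linarith
  have hl : 0 < Real.log x := Real.log_pos (by linarith)
  have hsq1 : 1 ≤ √x := Real.one_le_sqrt.mpr (by linarith)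
  have hR : 0 < 1 / Real.log x ^ ((1 : ℝ) / 6) := one_div_pos.mpr (Real.rpow_pos_of_pos hl _)
  have hbeta : 0 ≤ betaf f (√x) ^ ((1 : ℝ) / 4) := Real.rpow_nonneg (betaf_nonneg f hsq1) _
  have halpha := alphaf_nonneg f (x ^ (1 / Real.log (Real.log x)))
  have hE := main_err hadd hs hx0 y
  rw [← hB] at hE
  have hI := inv_sqrt_le (x := x) (by linarith)
  by_cases hxe : Real.log x ≤ 1
  · have h1 : 1 ≤ 1 / Real.log x ^ ((1 : ℝ) / 6) := by
      rw [le_div_iff₀ (Real.rpow_pos_of_pos hl _), one_mul]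
      exact Real.rpow_le_one hl.le hxe (by norm_num)
    have h2 : ∑' k : ℕ, (if √x < (k : ℝ) then bP (fun p => f p ≠ 0) k / k else 0) ≤ B := by
      have hle : ∀ k : ℕ, (if √x < (k : ℝ) then bP (fun p => f p ≠ 0) k / k else 0) ≤ bP (fun p => f p ≠ 0) k / k := by
        intro k
        split_ifs
        · exact le_rfl
        · exact div_nonneg (bP_nonneg _ _) (by positivity)
      refine Summable.tsum_le_tsum hle (Summable.of_nonneg_of_le (fun k => ?_) hle hs) hs
      split_ifs
      · exact div_nonneg (bP_nonneg _ _) (by positivity)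
      · exact le_rfl
    nlinarith [mul_le_mul_of_nonneg_left hI hB0, mul_le_mul_of_nonneg_left h1 hB0, mul_nonneg hB0 halpha,
      mul_nonneg hB0 hbeta, mul_nonneg hC halpha, mul_nonneg hC hbeta, mul_nonneg hC hR.le]
  · have hxe : 1 < Real.log x := not_le.mp hxe
    have hll : 0 < Real.log (Real.log x) := Real.log_pos hxe
    have hlb : Real.log (Real.log x) ≤ Real.log x / 2 := by
      have h3 : Real.log (Real.log x) = 2 * Real.log (√(Real.log x)) := by
        rw [Real.log_sqrt hl.le]; ring
      have h4 := Real.log_le_sub_one_of_pos (Real.sqrt_pos.mpr hl)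
      have h5 := Real.mul_self_sqrt hl.le
      nlinarith [sq_nonneg (√(Real.log x) - 2)]
    have hT1 := hT (x ^ (1 / Real.log (Real.log x))) (1 / 3 * (Real.log (Real.log x) / Real.log x)) (√x)
      (Real.one_le_rpow (by linarith) (by positivity)) (by positivity) ?_ ?_ (by linarith)
    · have hae : (∑' p : Nat.Primes, if x ^ (1 / Real.log (Real.log x)) < ((p : ℕ) : ℝ) then
          (@ite ℝ (f (p : ℕ) ≠ 0) (Classical.propDecidable _) ((1 : ℝ) / ((p : ℕ) : ℝ)) 0) else 0) =
          alphaf f (x ^ (1 / Real.log (Real.log x))) := by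
        rw [alphaf_eq]
        exact tsum_congr fun p => by congr
      rw [hae] at hT1
      have hY : √x ^ (1 / 3 * (Real.log (Real.log x) / Real.log x)) = Real.log x ^ ((1 : ℝ) / 6) := by
        rw [Real.rpow_def_of_pos (by linarith), Real.rpow_def_of_pos hl, Real.log_sqrt hx0.le]
        congr 1
        field_simp
        norm_num
      rw [hY] at hT1
      nlinarith [mul_le_mul_of_nonneg_left hI hB0, mul_nonneg hB0 halpha,
        mul_nonneg hB0 hbeta, mul_nonneg hC halpha, mul_nonneg hC hbeta, mul_nonneg hC hR.le, mul_nonneg hB0 hR.le]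
    · have : Real.log (Real.log x) / Real.log x ≤ 1 / 2 := by
        rw [div_le_iff₀ hl]; linarith
      linarith
    · rw [Real.rpow_def_of_pos (Real.rpow_pos_of_pos hx0 _), Real.log_rpow hx0]
      apply Real.exp_le_exp.mpr
      have : 1 / Real.log (Real.log x) * Real.log x * (1 / 3 * (Real.log (Real.log x) / Real.log x)) = 1 / 3 := by
        field_simp
      rw [this]; norm_num

/-- **Effective Erdős–Wintner theorem, discrete case** (Theorem 1.1):
if the two Erdős–Wintner series converge but `Σ_{f(p)≠0} 1/p < ∞`, then
uniformly for `x ≥ 2`,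
`‖F_x − F‖_∞ ≪ α_f(x^{1/log₂ x}) + β_f(√x)^{1/4} + 1/(log x)^{1/6}`. -/
theorem effective_erdos_wintner_discrete (f : ℕ → ℝ)
    (hadd : IsAdditive f) (hconv : EWConv f)
    (hfin : Summable (fun p : Nat.Primes => if f (p : ℕ) ≠ 0 then (1 : ℝ) / ((p : ℕ) : ℝ) else 0)) :
    ∃ C : ℝ, 0 < C ∧ ∀ x : ℝ, 2 ≤ x → ∀ y : ℝ,
      |Fx f x y - Flim f y| ≤
        C * (alphaf f (x ^ (1 / Real.log (Real.log x)))
          + betaf f (Real.sqrt x) ^ ((1:ℝ)/4)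
          + 1 / Real.log x ^ ((1:ℝ)/6)) := by
  exact main_thm f hadd hfin

end
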